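/- arXiv:1704.00170 — 5 statements merged into one kernel-verified Lean document; each statement's English description precedes it below -/
import Mathlib

section
/- Let d be a natural number and let f : ℂ × (Fin d → ℂ) → ℂ be analytic at the point (0, w₀), where w₀ : Fin d → ℂ. Suppose f is odd in the first variable near (0, w₀), i.e., there is a neighborhood U of (0, w₀) with f(−z₁, z′) = −f(z₁, z′) for all (z₁, z′) ∈ U. Then there exists a function g : ℂ × (Fin d → ℂ) → ℂ analytic at (0, w₀) such that f(z₁, z′) = z₁ · g(z₁, z′) for all (z₁, z′) in some neighborhood of (0, w₀), and g(0, w₀) equals the derivative at 0 of the one-variable function t ↦ f(t, w₀). -/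
open Topology Filter

section DirectionalQuotient

variable {𝕜 E F : Type*} [NontriviallyNormedField 𝕜] [NormedAddCommGroup E] [NormedSpace 𝕜 E]
  [NormedAddCommGroup F] [NormedSpace 𝕜 F]

/-- The coefficients of the difference quotient in direction `e` of a power series, obtained by
telescoping `p (x, …, x) - p (P x, …, P x)` when `x - P x` is a multiple of `e`. -/
noncomputable def FormalMultilinearSeries.directionalQuotient (p : FormalMultilinearSeries 𝕜 E F)
    (P : E →L[𝕜] E) (e : E) : FormalMultilinearSeries 𝕜 E F := fun n =>
  ∑ i : Fin (n + 1), ((p (n + 1)).curryMid i e).compContinuousLinearMap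
    fun j => if j.castSucc < i then P else ContinuousLinearMap.id 𝕜 E

namespace FormalMultilinearSeries

variable (p : FormalMultilinearSeries 𝕜 E F) (P : E →L[𝕜] E) (e : E)

lemma smul_directionalQuotient_apply {x : E} {c : 𝕜} (hx : x - P x = c • e) (n : ℕ) :
    c • p.directionalQuotient P e n (fun _ => x) =
      p (n + 1) (fun _ => x) - p (n + 1) (fun _ => P x) := by
  set Φ : ℕ → F := fun k => p (n + 1) fun j => if (j : ℕ) < k then P x else x with hΦ
  have key : ∀ i : Fin (n + 1),
      c • (((p (n + 1)).curryMid i e).compContinuousLinearMap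
        (fun j => if j.castSucc < i then P else ContinuousLinearMap.id 𝕜 E)) (fun _ => x) =
      Φ i - Φ (i + 1) := by
    intro i
    set m : Fin (n + 1) → E := fun j => if (j : ℕ) < i then P x else x with hm
    have h1 : Function.update m i x = fun j : Fin (n + 1) => if (j : ℕ) < i then P x else x := by
      ext j
      rcases eq_or_ne j i with rfl | hj <;> simp [*]
    have h2 : Function.update m i (P x) =
        fun j : Fin (n + 1) => if (j : ℕ) < i + 1 then P x else x := by
      ext j
      rcases eq_or_ne j i with rfl | hj
      · simp
      · have hj' : (j : ℕ) ≠ i := fun h => hj (Fin.ext h)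
        have : (j : ℕ) < i + 1 ↔ (j : ℕ) < i := by omega
        simp [hm, hj, this]
    have h3 : Function.update m i e = i.insertNth e
        (fun j : Fin n => (if j.castSucc < i then P else ContinuousLinearMap.id 𝕜 E) x) := by
      refine Fin.eq_insertNth_iff.2 ⟨by simp, ?_⟩
      ext j
      simp only [Fin.removeNth, Function.update_of_ne (Fin.succAbove_ne i j), hm]
      rcases lt_or_ge j.castSucc i with h | h
      · rw [Fin.succAbove_of_castSucc_lt _ _ h]
        have : (j : ℕ) < i := h
        simp [h, this]
      · rw [Fin.succAbove_of_le_castSucc _ _ h]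
        have : (i : ℕ) ≤ j := h
        have h' : ¬ ((j : ℕ) + 1 < i) := by omega
        simp [not_lt.2 h, h']
    simp only [hΦ]
    rw [← h1, ← h2, ← ContinuousMultilinearMap.map_update_sub, hx,
      ContinuousMultilinearMap.map_update_smul, h3]
    rfl
  rw [directionalQuotient, sum_apply, Finset.smul_sum,
    Finset.sum_congr rfl fun i _ => key i,
    Fin.sum_univ_eq_sum_range (fun i => Φ i - Φ (i + 1)), Finset.sum_range_sub']
  simp only [hΦ, Nat.not_lt_zero, if_false, Fin.is_lt, if_true]

lemma norm_directionalQuotient_le (n : ℕ) :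
    ‖p.directionalQuotient P e n‖ ≤ (n + 1) * (‖p (n + 1)‖ * ‖e‖ * (max 1 ‖P‖) ^ n) := by
  refine (norm_sum_le _ _).trans ?_
  have key : ∀ i ∈ (Finset.univ : Finset (Fin (n + 1))),
      ‖((p (n + 1)).curryMid i e).compContinuousLinearMap
        (fun j => if j.castSucc < i then P else ContinuousLinearMap.id 𝕜 E)‖ ≤
      ‖p (n + 1)‖ * ‖e‖ * (max 1 ‖P‖) ^ n := by
    intro i _
    refine (ContinuousMultilinearMap.norm_compContinuousLinearMap_le _ _).trans ?_
    gcongr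
    · exact (ContinuousLinearMap.le_opNorm _ _).trans_eq
        (by rw [ContinuousMultilinearMap.norm_curryMid])
    · refine (Finset.prod_le_prod (fun _ _ => norm_nonneg _) (g := fun _ => max 1 ‖P‖) ?_).trans_eq
        (by simp)
      intro j _
      split_ifs
      · exact le_max_right _ _
      · exact ContinuousLinearMap.norm_id_le.trans (le_max_left _ _)
  refine (Finset.sum_le_card_nsmul _ _ _ key).trans_eq ?_
  simp

lemma radius_directionalQuotient_pos (hp : 0 < p.radius) :
    0 < (p.directionalQuotient P e).radius := by
  obtain ⟨C, a, hC, ha, hCa⟩ := p.le_mul_pow_of_radius_pos hp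
  have hM : 0 < max 1 ‖P‖ := lt_max_of_lt_left one_pos
  set M := max 1 ‖P‖
  let r : NNReal := ⟨(2 * a * M)⁻¹, by positivity⟩
  have hr : 0 < r := by
    rw [← NNReal.coe_pos]
    change 0 < (2 * a * M)⁻¹
    positivity
  refine (ENNReal.coe_pos.2 hr).trans_le (le_radius_of_bound _ (C * a * ‖e‖) fun n => ?_)
  have hn : (n + 1 : ℝ) ≤ 2 ^ n := by exact_mod_cast Nat.lt_two_pow_self (n := n)
  calc ‖p.directionalQuotient P e n‖ * ((2 * a * M)⁻¹) ^ n
      ≤ (2 ^ n * (C * a ^ (n + 1) * ‖e‖ * M ^ n)) * ((2 * a * M)⁻¹) ^ n := by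
        gcongr
        refine (p.norm_directionalQuotient_le P e n).trans ?_
        gcongr
        exact hCa _
    _ = C * a * ‖e‖ := by
        rw [inv_pow, mul_pow, mul_pow]
        field_simp
        ring

end FormalMultilinearSeries

/-- Hadamard-type division: if `x - P x = ℓ x • e` for all `x`, then the difference between an
analytic function and its restriction along `P` is divisible by `ℓ`, with analytic quotient. -/
theorem AnalyticAt.exists_sub_eq_smul [CompleteSpace F] {f : E → F} {x₀ : E}
    (hf : AnalyticAt 𝕜 f x₀) (P : E →L[𝕜] E) (ℓ : E →L[𝕜] 𝕜) (e : E)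
    (h : ∀ x, x - P x = ℓ x • e) :
    ∃ g : E → F, AnalyticAt 𝕜 g x₀ ∧
      ∀ᶠ x in 𝓝 x₀, f x - f (x₀ + P (x - x₀)) = ℓ (x - x₀) • g x := by
  obtain ⟨p, hp⟩ := hf
  have hq := (p.directionalQuotient P e).hasFPowerSeriesOnBall
    (p.radius_directionalQuotient_pos P e hp.radius_pos)
  have hqx : HasFPowerSeriesAt (fun x => (p.directionalQuotient P e).sum (x - x₀))
      (p.directionalQuotient P e) x₀ := by
    simpa using (hq.comp_sub x₀).hasFPowerSeriesAt
  refine ⟨_, hqx.analyticAt, ?_⟩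
  have hP : Tendsto (fun x => x₀ + P (x - x₀)) (𝓝 x₀) (𝓝 x₀) := by
    have : Continuous fun x => x₀ + P (x - x₀) := by fun_prop
    simpa using this.tendsto x₀
  filter_upwards [hp.eventually_hasSum_sub, hP.eventually hp.eventually_hasSum_sub,
    hqx.eventually_hasSum_sub] with x h1 h2 h3
  simp only [add_sub_cancel_left] at h2
  have h4 := (hasSum_nat_add_iff' 1).2 (h1.sub h2)
  have h5 := h3.const_smul (ℓ (x - x₀))
  simp only [FormalMultilinearSeries.smul_directionalQuotient_apply p P e (h _)] at h5
  refine HasSum.unique ?_ h5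
  convert h4 using 1
  have : (fun _ : Fin 0 => x - x₀) = fun _ => P (x - x₀) := Subsingleton.elim _ _
  simp [this]

end DirectionalQuotient

/-- **Odd holomorphic divisibility lemma (several variables).**
Work on `ℂ × (Fin d → ℂ)`, points written `(z₁, z′)`.  If `f` is analytic at
`(0, w₀)` and odd in the first variable near `(0, w₀)`, then `f = z₁ · g` near
`(0, w₀)` for some `g` analytic at `(0, w₀)`, and
`g (0, w₀) = (d/dt) f (t, w₀) |_{t = 0}`. -/
theorem odd_analytic_div_multivar (d : ℕ) (w₀ : Fin d → ℂ)
    (f : ℂ × (Fin d → ℂ) → ℂ) (hf : AnalyticAt ℂ f ((0 : ℂ), w₀))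
    (hodd : ∀ᶠ p : ℂ × (Fin d → ℂ) in 𝓝 ((0 : ℂ), w₀), f (-p.1, p.2) = -f p) :
    ∃ g : ℂ × (Fin d → ℂ) → ℂ, AnalyticAt ℂ g ((0 : ℂ), w₀) ∧
      (∀ᶠ p : ℂ × (Fin d → ℂ) in 𝓝 ((0 : ℂ), w₀), f p = p.1 * g p) ∧
      g ((0 : ℂ), w₀) = deriv (fun t : ℂ => f (t, w₀)) 0 := by
  obtain ⟨g, hg, hfg⟩ := hf.exists_sub_eq_smul
    ((0 : ℂ × (Fin d → ℂ) →L[ℂ] ℂ).prod (ContinuousLinearMap.snd ℂ ℂ (Fin d → ℂ)))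
    (ContinuousLinearMap.fst ℂ ℂ (Fin d → ℂ)) (1, 0) (fun x => by ext <;> simp)
  have hproj : Tendsto (fun p : ℂ × (Fin d → ℂ) => ((0 : ℂ), p.2)) (𝓝 (0, w₀)) (𝓝 (0, w₀)) :=
    Continuous.tendsto (f := fun p : ℂ × (Fin d → ℂ) => ((0 : ℂ), p.2)) (by fun_prop) (0, w₀)
  have hdiv : ∀ᶠ p : ℂ × (Fin d → ℂ) in 𝓝 ((0 : ℂ), w₀), f p = p.1 * g p := by
    filter_upwards [hfg, hproj.eventually hodd] with p hp hp0
    have h0 : f (0, p.2) = 0 := by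
      simpa [self_eq_neg] using hp0
    simpa [h0] using hp
  refine ⟨g, hg, hdiv, ?_⟩
  have hslice : AnalyticAt ℂ (fun t : ℂ => (t, w₀)) 0 := analyticAt_id.prod analyticAt_const
  have hgt : DifferentiableAt ℂ (fun t : ℂ => g (t, w₀)) 0 :=
    (AnalyticAt.comp (g := g) (f := fun t : ℂ => (t, w₀)) hg hslice).differentiableAt
  have heq : (fun t : ℂ => f (t, w₀)) =ᶠ[𝓝 0] fun t => t * g (t, w₀) :=
    hslice.continuousAt.eventually hdiv
  rw [heq.deriv_eq]
  simpa using (deriv_fun_mul differentiableAt_fun_id hgt).symm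
end

section
/- Let a¹, …, aᴺ (N ≥ 1) be coefficient families, each τ-invariant and at most 1-singular on W, where W is admissible. Then the product a¹ ∘ a² ∘ ⋯ ∘ aᴺ is at most 1-singular at v, i.e., for every (m, μ) ∈ ℤ × (Fin d → ℤ) there exist an open neighborhood U of v and a function h analytic on U such that (a¹ ∘ ⋯ ∘ aᴺ)_{(m,μ)}(z₁, z′) = h(z₁, z′)/z₁ for all (z₁, z′) ∈ U with z₁ ≠ 0. -/
open Topology Filter

noncomputable section

/-- The involution `τ (z₁, z′) = (-z₁, z′)` on `ℂ × (Fin d → ℂ)`. -/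
def tauMap (d : ℕ) : ℂ × (Fin d → ℂ) → ℂ × (Fin d → ℂ) := fun p => (-p.1, p.2)

/-- Translation of a point by (minus) an integer vector `σ ∈ ℤ × (Fin d → ℤ)`:
`(z₁, z′) ↦ (z₁ - m, z′ - μ)`. -/
def shiftPt (d : ℕ) (σ : ℤ × (Fin d → ℤ)) (p : ℂ × (Fin d → ℂ)) :
    ℂ × (Fin d → ℂ) :=
  (p.1 - (σ.1 : ℂ), fun i => p.2 i - (σ.2 i : ℂ))

/-- A coefficient family: to each `(m, μ) ∈ ℤ × (Fin d → ℤ)` it assigns a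
function `ℂ × (Fin d → ℂ) → ℂ`. -/
abbrev Fam (d : ℕ) := (ℤ × (Fin d → ℤ)) → ℂ × (Fin d → ℂ) → ℂ

/-- The family is finitely supported. -/
def FinSuppFam (d : ℕ) (a : Fam d) : Prop := (Function.support a).Finite

/-- `τ`-invariance of a family: `a_{(-m,μ)} (z₁, z′) = a_{(m,μ)} (-z₁, z′)`. -/
def TauInvFam (d : ℕ) (a : Fam d) : Prop :=
  ∀ (m : ℤ) (μ : Fin d → ℤ) (p : ℂ × (Fin d → ℂ)),
    a (-m, μ) p = a (m, μ) (tauMap d p)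

/-- The family `a` is at most `1`-singular on `W`: each coefficient is of the
form `g / z₁` with `g` analytic on `W`. -/
def OneSingOn (d : ℕ) (W : Set (ℂ × (Fin d → ℂ))) (a : Fam d) : Prop :=
  ∀ σ : ℤ × (Fin d → ℤ), ∃ g : ℂ × (Fin d → ℂ) → ℂ, AnalyticOnNhd ℂ g W ∧
    ∀ p ∈ W, p.1 ≠ 0 → a σ p = g p / p.1

/-- `W` is admissible: open, contains `v = (0, w₀)`, and invariant under `τ`
and under all integer translations. -/
def Admissible (d : ℕ) (w₀ : Fin d → ℂ) (W : Set (ℂ × (Fin d → ℂ))) : Prop :=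
  IsOpen W ∧ ((0 : ℂ), w₀) ∈ W ∧ (∀ p ∈ W, tauMap d p ∈ W) ∧
    ∀ (σ : ℤ × (Fin d → ℤ)), ∀ p ∈ W, shiftPt d σ p ∈ W

/-- Product of two coefficient families (the skew group ring multiplication):
`(a ∘ b)_{(m,μ)} (z) = Σ_{σ₁ + σ₂ = (m,μ)} a_{σ₁} (z) · b_{σ₂} (z - σ₁)`. -/
def composeFam (d : ℕ) (a b : Fam d) : Fam d :=
  fun σ p => ∑ᶠ σ₁ : ℤ × (Fin d → ℤ), a σ₁ p * b (σ - σ₁) (shiftPt d σ₁ p)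

/-- The identity coefficient family. -/
def oneFam (d : ℕ) : Fam d := fun σ _ => if σ = 0 then 1 else 0

/-- Product `a¹ ∘ a² ∘ ⋯ ∘ aᴺ` of a list of coefficient families. -/
def prodFam (d : ℕ) : List (Fam d) → Fam d
  | [] => oneFam d
  | a :: l => composeFam d a (prodFam d l)

section Division

variable {𝕜 E F : Type*} [NontriviallyNormedField 𝕜] [NormedAddCommGroup E] [NormedSpace 𝕜 E]
  [NormedAddCommGroup F] [NormedSpace 𝕜 F]

/-- The projection of `𝕜 × E` onto its second factor, as an endomorphism. -/
noncomputable def killFst (𝕜 E : Type*) [NontriviallyNormedField 𝕜] [NormedAddCommGroup E]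
    [NormedSpace 𝕜 E] : 𝕜 × E →L[𝕜] 𝕜 × E :=
  (ContinuousLinearMap.inr 𝕜 𝕜 E).comp (ContinuousLinearMap.snd 𝕜 𝕜 E)

theorem killFst_apply (y : 𝕜 × E) : killFst 𝕜 E y = (0, y.2) := rfl

theorem norm_killFst_le : ‖killFst 𝕜 E‖ ≤ 1 :=
  ContinuousLinearMap.opNorm_le_bound _ zero_le_one fun y => by
    simp [killFst_apply, Prod.norm_def]

/-- The multilinear map obtained from an `n + 1`-linear map `f` on `𝕜 × E` by dividing
`f (y, …, y) - f ((0, y.2), …, (0, y.2))` by `y.1`. -/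
noncomputable def ContinuousMultilinearMap.divFst {n : ℕ}
    (f : ContinuousMultilinearMap 𝕜 (fun _ : Fin (n + 1) => 𝕜 × E) F) :
    ContinuousMultilinearMap 𝕜 (fun _ : Fin n => 𝕜 × E) F :=
  ∑ i : Fin (n + 1), (f.compContinuousLinearMap
    fun j => if j ≤ i then ContinuousLinearMap.id 𝕜 (𝕜 × E) else killFst 𝕜 E).curryMid i (1, 0)

theorem ContinuousMultilinearMap.smul_divFst_apply {n : ℕ}
    (f : ContinuousMultilinearMap 𝕜 (fun _ : Fin (n + 1) => 𝕜 × E) F) (y : 𝕜 × E) :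
    y.1 • f.divFst (fun _ => y) = f (fun _ => y) - f (fun _ => (0, y.2)) := by
  have h := f.toMultilinearMap.map_sub_map_piecewise (fun _ => y) (fun _ => (0, y.2)) Finset.univ
  rw [Finset.piecewise_univ] at h
  simp only [ContinuousMultilinearMap.coe_coe] at h
  rw [h, divFst, sum_apply, Finset.smul_sum]
  refine Finset.sum_congr rfl fun i _ => ?_
  rw [← smul_apply, ← map_smul, ContinuousMultilinearMap.curryMid_apply,
    ContinuousMultilinearMap.compContinuousLinearMap_apply]
  congr 1
  funext j
  obtain rfl | ⟨k, rfl⟩ := Fin.eq_self_or_eq_succAbove i j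
  · ext <;> simp
  · have hne : i ≠ i.succAbove k := (Fin.succAbove_ne i k).symm
    rcases lt_or_gt_of_ne hne with hlt | hlt
    · simp [hne, hlt.not_ge, hlt.not_gt, killFst_apply]
    · simp [hlt, hlt.le]

theorem ContinuousMultilinearMap.norm_divFst_le {n : ℕ}
    (f : ContinuousMultilinearMap 𝕜 (fun _ : Fin (n + 1) => 𝕜 × E) F) :
    ‖f.divFst‖ ≤ (n + 1) * ‖f‖ := by
  refine (norm_sum_le _ _).trans ?_
  have key : ∀ i ∈ (Finset.univ : Finset (Fin (n + 1))), ‖(f.compContinuousLinearMap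
      fun j => if j ≤ i then ContinuousLinearMap.id 𝕜 (𝕜 × E) else killFst 𝕜 E).curryMid i
        (1, 0)‖ ≤ ‖f‖ := fun i _ => by
    refine (ContinuousLinearMap.le_opNorm _ _).trans ?_
    have h1 : ‖((1, 0) : 𝕜 × E)‖ = 1 := by simp [Prod.norm_def]
    rw [h1, mul_one, ContinuousMultilinearMap.norm_curryMid]
    refine (f.norm_compContinuousLinearMap_le _).trans ?_
    refine mul_le_of_le_one_right (norm_nonneg _) (Finset.prod_le_one (fun _ _ => norm_nonneg _) ?_)
    intro j _
    split_ifs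
    · exact ContinuousLinearMap.norm_id_le
    · exact norm_killFst_le
  simpa using Finset.sum_le_sum key

/-- An analytic function of `(z, x) ∈ 𝕜 × E` minus its restriction to `z = 0` is divisible by `z`
in the ring of germs of analytic functions. -/
theorem AnalyticAt.exists_eq_add_fst_smul [CompleteSpace F] {h : 𝕜 × E → F} {w : E}
    (hh : AnalyticAt 𝕜 h (0, w)) :
    ∃ k : 𝕜 × E → F, AnalyticAt 𝕜 k (0, w) ∧ ∀ᶠ p in 𝓝 (0, w), h p = h (0, p.2) + p.1 • k p := by
  obtain ⟨q, r, hq⟩ := hh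
  let K : FormalMultilinearSeries 𝕜 (𝕜 × E) F := fun n => (q (n + 1)).divFst
  obtain ⟨s, hs0, hsr⟩ := ENNReal.lt_iff_exists_nnreal_btwn.1 (hq.r_pos.trans_le hq.r_le)
  have hs : 0 < s := by exact_mod_cast hs0
  obtain ⟨C, hC, hCq⟩ := q.norm_mul_pow_le_of_lt_radius hsr
  have hK : ((s / 2 : NNReal) : ENNReal) ≤ K.radius := by
    refine K.le_radius_of_bound (C / s) fun n => ?_
    have h2 : ((n : ℝ) + 1) ≤ 2 ^ n := by exact_mod_cast Nat.lt_two_pow_self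
    have hs' : (0 : ℝ) < s := hs
    rw [le_div_iff₀ hs']
    calc ‖K n‖ * ((s / 2 : NNReal) : ℝ) ^ n * s
        ≤ ((2 ^ n) * ‖q (n + 1)‖) * ((s / 2 : NNReal) : ℝ) ^ n * s := by
          gcongr
          exact (ContinuousMultilinearMap.norm_divFst_le _).trans (by gcongr)
      _ = ‖q (n + 1)‖ * (s : ℝ) ^ (n + 1) := by
          push_cast
          rw [div_pow]
          field_simp
          ring
      _ ≤ C := hCq _
  have hKpos : 0 < K.radius := lt_of_lt_of_le (by simpa using hs.ne') hK
  have hKs := K.hasFPowerSeriesOnBall hKpos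
  refine ⟨fun p => K.sum (p - (0, w)), ?_, ?_⟩
  · have := hKs.analyticAt
    refine AnalyticAt.fun_comp (g := K.sum) (f := fun p : 𝕜 × E => p - (0, w)) (by simpa using this)
      (by fun_prop)
  · have hc : Tendsto (fun p : 𝕜 × E => p - (0, w)) (𝓝 (0, w)) (𝓝 0) := by
      have : Continuous fun p : 𝕜 × E => p - (0, w) := by fun_prop
      simpa using this.tendsto (0, w)
    have hd : Tendsto (fun p : 𝕜 × E => ((0, (p - (0, w)).2) : 𝕜 × E)) (𝓝 (0, w)) (𝓝 0) := by
      have : Continuous fun p : 𝕜 × E => ((0, (p - (0, w)).2) : 𝕜 × E) := by fun_prop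
      simpa [Prod.zero_eq_mk] using this.tendsto (0, w)
    filter_upwards [hc (Metric.eball_mem_nhds 0 hq.r_pos), hd (Metric.eball_mem_nhds 0 hq.r_pos),
      hc (Metric.eball_mem_nhds 0 hKpos)] with p hp hp' hpK
    have h1 := hq.hasSum hp
    have h2 := hq.hasSum hp'
    have h3 := (hKs.hasSum hpK).const_smul p.1
    have h4 := (hasSum_nat_add_iff' 1).2 (h1.sub h2)
    have h5 : ∀ n, (q (n + 1) fun _ => p - (0, w)) - (q (n + 1) fun _ => (0, (p - (0, w)).2))
        = p.1 • K n fun _ => p - (0, w) := fun n => by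
      rw [← ContinuousMultilinearMap.smul_divFst_apply]; simp [K]
    simp only [h5] at h4
    have h6 := h4.unique h3
    have h0 : (q 0 fun _ => p - (0, w)) = (q 0 fun _ => (0, (p - (0, w)).2)) := by
      congr 1; exact Subsingleton.elim _ _
    simp [h0] at h6
    rw [← h6]; abel

end Division

/-- The involution `(m, μ) ↦ (-m, μ)` on the indices of a coefficient family. -/
def tauIdx (d : ℕ) : (ℤ × (Fin d → ℤ)) ≃ (ℤ × (Fin d → ℤ)) where
  toFun σ := (-σ.1, σ.2)
  invFun σ := (-σ.1, σ.2)
  left_inv σ := by simp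
  right_inv σ := by simp

theorem tauIdx_sub (d : ℕ) (σ ρ : ℤ × (Fin d → ℤ)) :
    tauIdx d (σ - ρ) = tauIdx d σ - tauIdx d ρ := by
  ext <;> simp [tauIdx]
  ring

theorem TauInvFam.apply_tauIdx {d : ℕ} {a : Fam d} (ha : TauInvFam d a)
    (σ : ℤ × (Fin d → ℤ)) (p : ℂ × (Fin d → ℂ)) : a (tauIdx d σ) p = a σ (tauMap d p) :=
  ha σ.1 σ.2 p

theorem shiftPt_shiftPt (d : ℕ) (σ ρ : ℤ × (Fin d → ℤ)) (p : ℂ × (Fin d → ℂ)) :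
    shiftPt d σ (shiftPt d ρ p) = shiftPt d (ρ + σ) p := by
  ext <;> simp [shiftPt] <;> ring

theorem tauMap_shiftPt_tauIdx (d : ℕ) (σ : ℤ × (Fin d → ℤ)) (p : ℂ × (Fin d → ℂ)) :
    tauMap d (shiftPt d (tauIdx d σ) p) = shiftPt d σ (tauMap d p) := by
  ext <;> simp [shiftPt, tauMap, tauIdx]
  ring

theorem analyticAt_tauMap (d : ℕ) (p : ℂ × (Fin d → ℂ)) : AnalyticAt ℂ (tauMap d) p :=
  analyticAt_fst.neg.prod analyticAt_snd

theorem analyticAt_shiftPt (d : ℕ) (σ : ℤ × (Fin d → ℤ)) (p : ℂ × (Fin d → ℂ)) :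
    AnalyticAt ℂ (shiftPt d σ) p :=
  (analyticAt_fst.sub analyticAt_const).prod
    (analyticAt_snd.sub (analyticAt_const (v := fun i => (σ.2 i : ℂ))))

theorem FinSuppFam.composeFam_apply {d : ℕ} {a : Fam d} (ha : FinSuppFam d a) (b : Fam d)
    (σ : ℤ × (Fin d → ℤ)) (p : ℂ × (Fin d → ℂ)) :
    composeFam d a b σ p = ∑ ρ ∈ ha.toFinset, a ρ p * b (σ - ρ) (shiftPt d ρ p) := by
  refine finsum_eq_sum_of_support_subset _ fun ρ hρ => ?_
  refine (Set.Finite.mem_toFinset ha).2 fun h0 => ?_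
  simp [h0] at hρ

theorem FinSuppFam.compose {d : ℕ} {a b : Fam d} (ha : FinSuppFam d a)
    (hb : FinSuppFam d b) : FinSuppFam d (composeFam d a b) := by
  refine (Set.Finite.image2 (· + ·) ha hb).subset fun σ hσ => ?_
  by_contra hn
  refine hσ (funext fun p => ?_)
  refine (finsum_congr fun ρ => ?_).trans finsum_zero
  by_cases h1 : a ρ = 0
  · simp [h1]
  · by_cases h2 : b (σ - ρ) = 0
    · simp [h2]
    · exact absurd ⟨ρ, h1, σ - ρ, h2, by simp⟩ hn

theorem TauInvFam.compose {d : ℕ} {a b : Fam d} (ha : TauInvFam d a)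
    (hb : TauInvFam d b) : TauInvFam d (composeFam d a b) := by
  intro m μ p
  change ∑ᶠ _, _ = ∑ᶠ _, _
  rw [← finsum_comp_equiv (tauIdx d)]
  refine finsum_congr fun ρ => ?_
  rw [ha.apply_tauIdx, ← tauMap_shiftPt_tauIdx, ← hb.apply_tauIdx, tauIdx_sub]
  rfl

theorem composeFam_assoc {d : ℕ} {a b : Fam d} (ha : FinSuppFam d a) (hb : FinSuppFam d b)
    (c : Fam d) :
    composeFam d (composeFam d a b) c = composeFam d a (composeFam d b c) := by
  funext σ p
  rw [ha.composeFam_apply, composeFam]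
  simp only [ha.composeFam_apply, Finset.sum_mul]
  have hfin : ∀ ρ ∈ ha.toFinset, (Function.support fun κ =>
      a ρ p * b (κ - ρ) (shiftPt d ρ p) * c (σ - κ) (shiftPt d κ p)).Finite := fun ρ _ => by
    refine (hb.image (· + ρ)).subset fun κ hκ => ⟨κ - ρ, fun h0 => ?_, by simp⟩
    simp [h0] at hκ
  rw [finsum_sum_comm _ _ hfin]
  refine Finset.sum_congr rfl fun ρ hρ => ?_
  rw [composeFam, mul_finsum, ← finsum_comp_equiv (Equiv.addLeft ρ)]
  refine finsum_congr fun κ => ?_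
  simp [shiftPt_shiftPt, mul_assoc, sub_sub]

theorem composeFam_oneFam {d : ℕ} (a : Fam d) : composeFam d a (oneFam d) = a := by
  funext σ p
  rw [composeFam, finsum_eq_single _ σ]
  · simp [oneFam]
  · intro ρ hρ
    simp [oneFam, sub_eq_zero, hρ.symm]

/-- `f` has at most a simple pole along `z₁ = 0` at `x`. -/
def SimplePoleAt {E : Type*} [NormedAddCommGroup E] [NormedSpace ℂ E] (f : ℂ × E → ℂ)
    (x : ℂ × E) : Prop :=
  ∃ h : ℂ × E → ℂ, AnalyticAt ℂ h x ∧ ∀ᶠ p in 𝓝 x, p.1 ≠ 0 → f p = h p / p.1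

theorem SimplePoleAt.sum {E ι : Type*} [NormedAddCommGroup E] [NormedSpace ℂ E]
    {f : ι → ℂ × E → ℂ} {x : ℂ × E} (s : Finset ι) (hf : ∀ i ∈ s, SimplePoleAt (f i) x) :
    SimplePoleAt (fun p => ∑ i ∈ s, f i p) x := by
  choose! h hh hfh using hf
  refine ⟨fun p => ∑ i ∈ s, h i p, Finset.analyticAt_fun_sum s hh, ?_⟩
  filter_upwards [(Filter.eventually_all_finset s).2 hfh] with p hp hp0
  rw [Finset.sum_div]
  exact Finset.sum_congr rfl fun i hi => hp i hi hp0

/-- A function with at most a simple pole along `z₁ = 0` that is even in `z₁` is regular. -/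
theorem SimplePoleAt.exists_analyticAt_of_even {d : ℕ} {f : ℂ × (Fin d → ℂ) → ℂ}
    {w : Fin d → ℂ} (hf : SimplePoleAt f (0, w)) (heven : ∀ p, f (tauMap d p) = f p) :
    ∃ k : ℂ × (Fin d → ℂ) → ℂ, AnalyticAt ℂ k (0, w) ∧
      ∀ᶠ p in 𝓝 (0, w), p.1 ≠ 0 → f p = k p := by
  obtain ⟨h, hh, hfh⟩ := hf
  obtain ⟨k, hk, hhk⟩ := hh.exists_eq_add_fst_smul
  have hv : tauMap d (0, w) = (0, w) := by simp [tauMap]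
  have ht : Tendsto (tauMap d) (𝓝 (0, w)) (𝓝 (0, w)) := by
    simpa only [ContinuousAt, hv] using (analyticAt_tauMap d (0, w)).continuousAt
  have hkt : AnalyticAt ℂ (fun p => k (tauMap d p)) (0, w) :=
    AnalyticAt.fun_comp (g := k) (f := tauMap d) (by rwa [hv]) (analyticAt_tauMap d _)
  refine ⟨fun p => (k (tauMap d p) + k p) / 2, (hkt.add hk).div_const, ?_⟩
  filter_upwards [hfh, hhk, ht.eventually hfh, ht.eventually hhk] with p h1 h2 h3 h4 hp
  have h5 := h1 hp
  have h6 := h3 (neg_ne_zero.2 hp)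
  rw [heven, h4] at h6
  rw [h2] at h5
  simp only [tauMap, smul_eq_mul] at h5 h6 ⊢
  field_simp at h5 h6 ⊢
  apply mul_left_cancel₀ hp
  linear_combination h5 + h6

theorem SimplePoleAt.compose {d : ℕ} {w₀ : Fin d → ℂ} {W : Set (ℂ × (Fin d → ℂ))}
    (hW : Admissible d w₀ W) {a b : Fam d} (hfin : FinSuppFam d a) (htau : TauInvFam d a)
    (ha : ∀ σ, SimplePoleAt (a σ) (0, w₀)) (hb : OneSingOn d W b) (σ : ℤ × (Fin d → ℤ)) :
    SimplePoleAt (composeFam d a b σ) (0, w₀) := by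
  have heq : composeFam d a b σ = _ := funext (hfin.composeFam_apply b σ)
  rw [heq]
  refine SimplePoleAt.sum _ fun ρ _ => ?_
  obtain ⟨g, hg, hbg⟩ := hb (σ - ρ)
  have hvW : shiftPt d ρ (0, w₀) ∈ W := hW.2.2.2 ρ _ hW.2.1
  have hgs : AnalyticAt ℂ (fun p => g (shiftPt d ρ p)) (0, w₀) :=
    AnalyticAt.fun_comp (hg _ hvW) (analyticAt_shiftPt d ρ _)
  have hmem : ∀ᶠ p in 𝓝 (0, w₀), shiftPt d ρ p ∈ W :=
    (analyticAt_shiftPt d ρ _).continuousAt (hW.1.mem_nhds hvW)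
  by_cases hρ : ρ.1 = 0
  · obtain ⟨k, hk, hak⟩ := (ha ρ).exists_analyticAt_of_even fun p => by
      rw [← htau.apply_tauIdx]
      congr 1
      ext <;> simp [tauIdx, hρ]
    refine ⟨fun p => k p * g (shiftPt d ρ p), hk.mul hgs, ?_⟩
    filter_upwards [hak, hmem] with p h1 h2 hp
    have h3 : (shiftPt d ρ p).1 = p.1 := by simp [shiftPt, hρ]
    rw [h1 hp, hbg _ h2 (h3 ▸ hp), h3, mul_div_assoc]
  · obtain ⟨h, hh, hah⟩ := ha ρ
    have hfst : AnalyticAt ℂ (fun p => (shiftPt d ρ p).1) (0, w₀) :=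
      analyticAt_fst.fun_comp (analyticAt_shiftPt d ρ _)
    have hne : (shiftPt d ρ (0, w₀)).1 ≠ 0 := by simpa [shiftPt] using hρ
    refine ⟨fun p => h p * (g (shiftPt d ρ p) / (shiftPt d ρ p).1),
      hh.mul (hgs.div hfst hne), ?_⟩
    filter_upwards [hah, hmem, hfst.continuousAt.eventually_ne hne] with p h1 h2 h3 hp
    rw [h1 hp, hbg _ h2 h3, div_mul_eq_mul_div]

theorem simplePoleAt_composeFam_prodFam {d : ℕ} {w₀ : Fin d → ℂ} {W : Set (ℂ × (Fin d → ℂ))}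
    (hW : Admissible d w₀ W) (l : List (Fam d)) (hfin : ∀ a ∈ l, FinSuppFam d a)
    (htau : ∀ a ∈ l, TauInvFam d a) (hsing : ∀ a ∈ l, OneSingOn d W a) (a : Fam d)
    (hafin : FinSuppFam d a) (hatau : TauInvFam d a) (ha : ∀ σ, SimplePoleAt (a σ) (0, w₀))
    (σ : ℤ × (Fin d → ℤ)) : SimplePoleAt (composeFam d a (prodFam d l) σ) (0, w₀) := by
  induction l generalizing a with
  | nil =>
    rw [prodFam, composeFam_oneFam]
    exact ha σ
  | cons b l ih =>
    simp only [List.forall_mem_cons] at hfin htau hsing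
    rw [prodFam, ← composeFam_assoc hafin hfin.1]
    exact ih hfin.2 htau.2 hsing.2 _ (hafin.compose hfin.1) (hatau.compose htau.1)
      (SimplePoleAt.compose hW hafin hatau ha hsing.1)

/-- **Proposition 3.1 of the paper.**  A product `a¹ ∘ ⋯ ∘ aᴺ` (`N ≥ 1`) of
finitely supported, `τ`-invariant, at most `1`-singular coefficient families on
an admissible `W` is at most `1`-singular at `v = (0, w₀)`: every coefficient
of the product is of the form `h / z₁` near `v` with `h` analytic near `v`. -/
theorem prod_one_singular (d : ℕ) (w₀ : Fin d → ℂ)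
    (W : Set (ℂ × (Fin d → ℂ))) (hW : Admissible d w₀ W)
    (l : List (Fam d)) (hl : l ≠ [])
    (hfin : ∀ a ∈ l, FinSuppFam d a)
    (htau : ∀ a ∈ l, TauInvFam d a)
    (hsing : ∀ a ∈ l, OneSingOn d W a) :
    ∀ σ : ℤ × (Fin d → ℤ), ∃ U : Set (ℂ × (Fin d → ℂ)),
      IsOpen U ∧ ((0 : ℂ), w₀) ∈ U ∧
      ∃ h : ℂ × (Fin d → ℂ) → ℂ, AnalyticOnNhd ℂ h U ∧
        ∀ p ∈ U, p.1 ≠ 0 → prodFam d l σ p = h p / p.1 := by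
  intro σ
  obtain ⟨a, l, rfl⟩ := List.exists_cons_of_ne_nil hl
  simp only [List.forall_mem_cons] at hfin htau hsing
  have ha : ∀ ρ, SimplePoleAt (a ρ) (0, w₀) := fun ρ => by
    obtain ⟨g, hg, hag⟩ := hsing.1 ρ
    exact ⟨g, hg _ hW.2.1, Filter.eventually_of_mem (hW.1.mem_nhds hW.2.1) hag⟩
  obtain ⟨h, hh, hph⟩ := simplePoleAt_composeFam_prodFam hW l hfin.2 htau.2 hsing.2 a hfin.1
    htau.1 ha σ
  obtain ⟨U, hU, hUo, hvU⟩ := eventually_nhds_iff.1 (hh.eventually_analyticAt.and hph)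
  exact ⟨U, hUo, hvU, h, fun p hp => (hU p hp).1, fun p hp => (hU p hp).2⟩

end
end

section
/- Let a be a coefficient family that is τ-invariant and at most 1-singular on W, where W is an open neighborhood of v invariant under τ. Then every τ-fixed coefficient of a extends analytically across z₁ = 0 at v: for each μ ∈ Fin d → ℤ there exist an open neighborhood U of v and a function h analytic on U such that a_{(0,μ)}(z₁, z′) = h(z₁, z′) for all (z₁, z′) ∈ U with z₁ ≠ 0. Equivalently, the analytic witness g_{(0,μ)} with a_{(0,μ)} = g_{(0,μ)}/z₁ is divisible by z₁ near v. -/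
open Topology Filter

noncomputable section

section Division

variable {𝕜 E F : Type*} [NontriviallyNormedField 𝕜]
  [NormedAddCommGroup E] [NormedSpace 𝕜 E] [NormedAddCommGroup F] [NormedSpace 𝕜 F]

/-- The projection `(z, w) ↦ (0, w)` of `𝕜 × E` onto its second factor. -/
def sndProj (𝕜 E : Type*) [NontriviallyNormedField 𝕜] [NormedAddCommGroup E]
    [NormedSpace 𝕜 E] : 𝕜 × E →L[𝕜] 𝕜 × E :=
  (ContinuousLinearMap.inr 𝕜 𝕜 E).comp (ContinuousLinearMap.snd 𝕜 𝕜 E)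

@[simp]
lemma sndProj_apply (y : 𝕜 × E) : sndProj 𝕜 E y = (0, y.2) := rfl

lemma norm_sndProj_apply_le (y : 𝕜 × E) : ‖sndProj 𝕜 E y‖ ≤ ‖y‖ := by
  simp [Prod.norm_def]

lemma norm_sndProj_le : ‖sndProj 𝕜 E‖ ≤ 1 :=
  ContinuousLinearMap.opNorm_le_bound _ zero_le_one fun y => by
    simpa only [one_mul] using norm_sndProj_apply_le y

/-- The power series whose product with the first coordinate is
`y ↦ ∑ₙ (pₙ (y, …, y) - pₙ (P y, …, P y))`, where `P` is the projection `sndProj`. -/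
def fstQuotientSeries (p : FormalMultilinearSeries 𝕜 (𝕜 × E) F) :
    FormalMultilinearSeries 𝕜 (𝕜 × E) F := fun n =>
  ∑ i : Fin (n + 1), ((p (n + 1)).curryMid i (1, 0)).compContinuousLinearMap
    fun j => if i.succAbove j < i then ContinuousLinearMap.id 𝕜 (𝕜 × E) else sndProj 𝕜 E

lemma fst_smul_fstQuotientSeries (p : FormalMultilinearSeries 𝕜 (𝕜 × E) F) (n : ℕ)
    (y : 𝕜 × E) :
    y.1 • fstQuotientSeries p n (fun _ => y) =
      p (n + 1) (fun _ => y) - p (n + 1) (fun _ => sndProj 𝕜 E y) := by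
  have h := (p (n + 1)).toMultilinearMap.map_sub_map_piecewise
    (fun _ => y) (fun _ => sndProj 𝕜 E y) Finset.univ
  simp only [Finset.piecewise_univ, ContinuousMultilinearMap.coe_coe, Finset.mem_univ,
    forall_true_left] at h
  rw [h, fstQuotientSeries, sum_apply, Finset.smul_sum]
  refine Finset.sum_congr rfl fun i _ => ?_
  rw [ContinuousMultilinearMap.compContinuousLinearMap_apply,
    ← smul_apply, ← map_smul,
    ContinuousMultilinearMap.curryMid_apply]
  congr 1
  funext j
  refine Fin.succAboveCases i ?_ (fun k => ?_) j
  · ext <;> simp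
  · have hk : i ≠ i.succAbove k := (Fin.succAbove_ne i k).symm
    rw [Fin.insertNth_apply_succAbove, if_neg hk]
    split_ifs <;> rfl

lemma norm_fstQuotientSeries_le (p : FormalMultilinearSeries 𝕜 (𝕜 × E) F) (n : ℕ) :
    ‖fstQuotientSeries p n‖ ≤ (n + 1) * ‖p (n + 1)‖ := by
  have hterm : ∀ i : Fin (n + 1), ‖((p (n + 1)).curryMid i (1, 0)).compContinuousLinearMap
      (fun j => if i.succAbove j < i then ContinuousLinearMap.id 𝕜 (𝕜 × E)
        else sndProj 𝕜 E)‖ ≤ ‖p (n + 1)‖ := by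
    intro i
    refine (ContinuousMultilinearMap.norm_compContinuousLinearMap_le _ _).trans ?_
    have h1 : ‖(p (n + 1)).curryMid i (1, 0)‖ ≤ ‖p (n + 1)‖ := by
      refine (ContinuousLinearMap.le_opNorm _ _).trans ?_
      rw [ContinuousMultilinearMap.norm_curryMid]
      simp [Prod.norm_def]
    refine (mul_le_of_le_one_right (norm_nonneg _) ?_).trans h1
    refine Finset.prod_le_one (fun _ _ => norm_nonneg _) fun j _ => ?_
    split_ifs
    · exact ContinuousLinearMap.norm_id_le
    · exact norm_sndProj_le
  refine (norm_sum_le _ _).trans ((Finset.sum_le_sum fun i _ => hterm i).trans ?_)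
  simp

lemma fstQuotientSeries_radius_pos {p : FormalMultilinearSeries 𝕜 (𝕜 × E) F}
    (hp : 0 < p.radius) : 0 < (fstQuotientSeries p).radius := by
  obtain ⟨C, r, hC, hr, hbound⟩ := p.le_mul_pow_of_radius_pos hp
  have hs : 0 < (2 * r)⁻¹ := by positivity
  lift (2 * r)⁻¹ to NNReal using hs.le with s hs'
  refine lt_of_lt_of_le (by exact_mod_cast hs)
    ((fstQuotientSeries p).le_radius_of_bound (r := s) (C * r) fun n => ?_)
  have hn : (n + 1 : ℝ) ≤ 2 ^ n := by exact_mod_cast Nat.lt_two_pow_self (n := n)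
  calc ‖fstQuotientSeries p n‖ * (s : ℝ) ^ n
      ≤ (2 ^ n * (C * r ^ (n + 1))) * (s : ℝ) ^ n := by
        gcongr
        refine (norm_fstQuotientSeries_le p n).trans ?_
        gcongr
        exact hbound _
    _ = C * r := by
        rw [hs', inv_pow, mul_pow, pow_succ]
        field_simp

/-- An analytic function vanishing on the hyperplane `z = 0` near a point of it is there the
product of the coordinate `z` with an analytic function. -/
theorem AnalyticAt.exists_eventuallyEq_fst_smul [CompleteSpace F] {f : 𝕜 × E → F} {w₀ : E}
    (hf : AnalyticAt 𝕜 f (0, w₀)) (hzero : ∀ᶠ w in 𝓝 w₀, f (0, w) = 0) :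
    ∃ h : 𝕜 × E → F, AnalyticAt 𝕜 h (0, w₀) ∧
      ∀ᶠ y in 𝓝 ((0 : 𝕜), w₀), f y = y.1 • h y := by
  obtain ⟨p, hp⟩ := hf
  set v : 𝕜 × E := (0, w₀) with hv
  have hq := (fstQuotientSeries p).hasFPowerSeriesOnBall
    (fstQuotientSeries_radius_pos hp.radius_pos)
  have hqv := hq.comp_sub v
  rw [zero_add] at hqv
  refine ⟨_, hqv.analyticAt, ?_⟩
  have hpsum := hp.eventually_hasSum_sub
  have hproj : Tendsto (fun y : 𝕜 × E => ((0 : 𝕜), y.2)) (𝓝 v) (𝓝 v) :=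
    Continuous.tendsto' (by fun_prop) _ _ rfl
  filter_upwards [hpsum, hproj.eventually hpsum, continuous_snd.continuousAt.eventually hzero,
    hqv.hasFPowerSeriesAt.eventually_hasSum_sub] with y h1 h2 h3 h4
  have h5 := h1.sub h2
  rw [h3, sub_zero, ← hasSum_nat_add_iff' 1] at h5
  have h0 : (fun _ : Fin 0 => y - v) = fun _ : Fin 0 => ((0 : 𝕜), y.2) - v :=
    Subsingleton.elim _ _
  simp only [Finset.range_one, Finset.sum_singleton, h0, sub_self, sub_zero] at h5
  refine h5.unique ?_
  convert h4.const_smul y.1 using 2 with n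
  have h6 := fst_smul_fstQuotientSeries p n (y - v)
  have h7 : (y - v).1 = y.1 := by simp [hv]
  have h8 : sndProj 𝕜 E (y - v) = ((0 : 𝕜), y.2) - v := by simp [hv]
  rw [h7, h8] at h6
  exact h6.symm

end Division

/-- A function that is continuous at `0` and odd on a punctured neighborhood of `0` vanishes
at `0`. -/
lemma ContinuousAt.eq_zero_of_eventually_odd {f : ℂ → ℂ} (hf : ContinuousAt f 0)
    (hodd : ∀ᶠ z in 𝓝[≠] (0 : ℂ), f (-z) = -f z) : f 0 = 0 := by
  have hneg : Tendsto (fun z : ℂ => f (-z)) (𝓝[≠] 0) (𝓝 (f 0)) := by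
    have h : Tendsto (fun z : ℂ => -z) (𝓝[≠] 0) (𝓝 0) :=
      (Continuous.tendsto' continuous_neg _ _ neg_zero).mono_left nhdsWithin_le_nhds
    exact hf.tendsto.comp h
  have hpos : Tendsto (fun z : ℂ => -f z) (𝓝[≠] 0) (𝓝 (-f 0)) :=
    (hf.tendsto.mono_left nhdsWithin_le_nhds).neg
  exact self_eq_neg.mp (tendsto_nhds_unique (hneg.congr' hodd) hpos)

/-- **Key step in the proof of Proposition 3.1 of the paper.**  If `a` is a
`τ`-invariant coefficient family, at most `1`-singular on a `τ`-invariant open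
neighborhood `W` of `v = (0, w₀)`, then every coefficient of `a` at a
`τ`-fixed group element `(0, μ)` extends analytically across `z₁ = 0` at `v`:
near `v` it agrees (off `z₁ = 0`) with a function analytic near `v`. -/
theorem tau_fixed_coefficient_holomorphic (d : ℕ) (w₀ : Fin d → ℂ)
    (W : Set (ℂ × (Fin d → ℂ))) (hWopen : IsOpen W)
    (hvW : ((0 : ℂ), w₀) ∈ W) (hWtau : ∀ p ∈ W, tauMap d p ∈ W)
    (a : Fam d) (hfin : FinSuppFam d a) (htau : TauInvFam d a)
    (hsing : OneSingOn d W a) :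
    ∀ μ : Fin d → ℤ, ∃ U : Set (ℂ × (Fin d → ℂ)),
      IsOpen U ∧ ((0 : ℂ), w₀) ∈ U ∧
      ∃ h : ℂ × (Fin d → ℂ) → ℂ, AnalyticOnNhd ℂ h U ∧
        ∀ p ∈ U, p.1 ≠ 0 → a (0, μ) p = h p := by
  intro μ
  obtain ⟨g, hg, hag⟩ := hsing (0, μ)
  have hvanish : ∀ w : Fin d → ℂ, ((0 : ℂ), w) ∈ W → g (0, w) = 0 := by
    intro w hw
    have hline : Continuous fun z : ℂ => (z, w) := by fun_prop
    refine ContinuousAt.eq_zero_of_eventually_odd (f := fun z => g (z, w))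
      ((hg _ hw).continuousAt.comp (f := fun z : ℂ => (z, w)) hline.continuousAt) ?_
    have hmem : ∀ᶠ z in 𝓝[≠] (0 : ℂ), (z, w) ∈ W :=
      nhdsWithin_le_nhds (hline.continuousAt.eventually (hWopen.mem_nhds hw))
    filter_upwards [hmem, self_mem_nhdsWithin] with z hz hz0
    have hz0 : z ≠ 0 := hz0
    have h1 := hag _ hz hz0
    have h2 := hag _ (hWtau _ hz) (neg_ne_zero.mpr hz0)
    have h3 := htau 0 μ (z, w)
    rw [neg_zero, h1, h2] at h3
    simp only [tauMap] at h3
    field_simp at h3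
    rw [h3, neg_neg]
  have hslice : ∀ᶠ w in 𝓝 w₀, ((0 : ℂ), w) ∈ W :=
    (Continuous.continuousAt (f := fun w : Fin d → ℂ => ((0 : ℂ), w))
      (by fun_prop)).eventually (hWopen.mem_nhds hvW)
  obtain ⟨h, hh, hgh⟩ := (hg _ hvW).exists_eventuallyEq_fst_smul (hslice.mono hvanish)
  obtain ⟨U, hU, hUopen, hvU⟩ := eventually_nhds_iff.mp
    ((hh.eventually_analyticAt.and hgh).and (hWopen.mem_nhds hvW))
  refine ⟨U, hUopen, hvU, h, fun p hp => (hU p hp).1.1, fun p hp hp0 => ?_⟩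
  rw [hag p (hU p hp).2 hp0, (hU p hp).1.2, smul_eq_mul, mul_div_cancel_left₀ _ hp0]


end
end

section
/- For (m, μ) ∈ ℤ × (Fin d → ℤ), define functionals on the space E of entire functions F : ℂ × (Fin d → ℂ) → ℂ satisfying F ∘ τ = F by D¹_{(m,μ)}(F) = (1/2)(F(−m, w₀ − μ) + F(m, w₀ − μ)) and D²_{(m,μ)}(F) = the derivative at −m of the one-variable function t ↦ F(t, w₀ − μ). Let c and c′ be finitely supported functions ℤ × (Fin d → ℤ) → ℂ, with c supported on {(m, μ) : m ≤ 0} and c′ supported on {(m, μ) : m < 0}. If Σ_{(m,μ)} c_{(m,μ)} D¹_{(m,μ)}(F) + Σ_{(m,μ)} c′_{(m,μ)} D²_{(m,μ)}(F) = 0 for every F ∈ E, then c = 0 and c′ = 0. -/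
open Topology Filter

noncomputable section

/-- The distribution `D¹_{(m,μ)} (F) = ½ (F (-m, w₀ - μ) + F (m, w₀ - μ))`. -/
def D1 (d : ℕ) (w₀ : Fin d → ℂ) (σ : ℤ × (Fin d → ℤ))
    (F : ℂ × (Fin d → ℂ) → ℂ) : ℂ :=
  (1 / 2) * (F (-(σ.1 : ℂ), fun i => w₀ i - (σ.2 i : ℂ)) +
    F ((σ.1 : ℂ), fun i => w₀ i - (σ.2 i : ℂ)))

/-- The distribution `D²_{(m,μ)} (F) = (d/dt) F (t, w₀ - μ) |_{t = -m}`. -/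
def D2 (d : ℕ) (w₀ : Fin d → ℂ) (σ : ℤ × (Fin d → ℤ))
    (F : ℂ × (Fin d → ℂ) → ℂ) : ℂ :=
  deriv (fun t : ℂ => F (t, fun i => w₀ i - (σ.2 i : ℂ))) (-(σ.1 : ℂ))

/-- The even function `(t, w) ↦ G (t²) * R w` attached to a polynomial `G` and a function `R`. -/
def evenProduct (d : ℕ) (G : Polynomial ℂ) (R : (Fin d → ℂ) → ℂ) : ℂ × (Fin d → ℂ) → ℂ :=
  fun p => G.eval (p.1 ^ 2) * R p.2

lemma evenProduct_tauMap (d : ℕ) (G : Polynomial ℂ) (R : (Fin d → ℂ) → ℂ)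
    (p : ℂ × (Fin d → ℂ)) : evenProduct d G R (tauMap d p) = evenProduct d G R p := by
  simp [evenProduct, tauMap]

lemma analyticOnNhd_evenProduct (d : ℕ) (G : Polynomial ℂ) {R : (Fin d → ℂ) → ℂ}
    (hR : ∀ w, AnalyticAt ℂ R w) : AnalyticOnNhd ℂ (evenProduct d G R) Set.univ := by
  intro p _
  have h : AnalyticAt ℂ (fun q : ℂ × (Fin d → ℂ) => q.1 ^ 2) p := analyticAt_fst.pow 2
  have hG : AnalyticAt ℂ (fun q : ℂ × (Fin d → ℂ) => G.eval (q.1 ^ 2)) p := by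
    simpa [Polynomial.aeval_def, Polynomial.eval₂_eq_eval_map] using h.aeval_polynomial G
  exact hG.mul ((hR p.2).comp analyticAt_snd)

lemma D1_evenProduct (d : ℕ) (w₀ : Fin d → ℂ) (σ : ℤ × (Fin d → ℤ)) (G : Polynomial ℂ)
    (R : (Fin d → ℂ) → ℂ) :
    D1 d w₀ σ (evenProduct d G R) =
      G.eval ((σ.1 : ℂ) ^ 2) * R (fun i => w₀ i - (σ.2 i : ℂ)) := by
  simp only [D1, evenProduct, neg_sq]
  ring

lemma D2_evenProduct (d : ℕ) (w₀ : Fin d → ℂ) (σ : ℤ × (Fin d → ℤ)) (G : Polynomial ℂ)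
    (R : (Fin d → ℂ) → ℂ) :
    D2 d w₀ σ (evenProduct d G R) =
      G.derivative.eval ((σ.1 : ℂ) ^ 2) * (-2 * (σ.1 : ℂ)) *
        R (fun i => w₀ i - (σ.2 i : ℂ)) := by
  have h1 : HasDerivAt (fun t : ℂ => t ^ 2) (2 * (-(σ.1 : ℂ))) (-(σ.1 : ℂ)) := by
    simpa using hasDerivAt_pow 2 (-(σ.1 : ℂ))
  have h2 := ((G.hasDerivAt ((-(σ.1 : ℂ)) ^ 2)).comp (-(σ.1 : ℂ)) h1).mul_const
    (R (fun i => w₀ i - (σ.2 i : ℂ)))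
  refine h2.deriv.trans ?_
  rw [neg_sq]
  ring

/-- An entire function separating one integral translate of `w₀` from finitely many others. -/
lemma exists_analytic_separating (d : ℕ) (w₀ : Fin d → ℂ) (M : Finset (Fin d → ℤ))
    (ν : Fin d → ℤ) :
    ∃ R : (Fin d → ℂ) → ℂ, (∀ w, AnalyticAt ℂ R w) ∧
      R (fun i => w₀ i - (ν i : ℂ)) ≠ 0 ∧
      ∀ μ ∈ M, μ ≠ ν → R (fun i => w₀ i - (μ i : ℂ)) = 0 := by
  classical
  refine ⟨fun w => ∏ i, ∏ k ∈ (M.image (· i)).erase (ν i), (w i - (w₀ i - (k : ℂ))),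
    ?_, ?_, ?_⟩
  · intro w
    refine Finset.analyticAt_fun_prod _ fun i _ => Finset.analyticAt_fun_prod _ fun k _ => ?_
    exact ((ContinuousLinearMap.proj (R := ℂ) (φ := fun _ : Fin d => ℂ) i).analyticAt w).sub
      analyticAt_const
  · refine Finset.prod_ne_zero_iff.2 fun i _ => Finset.prod_ne_zero_iff.2 fun k hk => ?_
    have hne : (k : ℂ) ≠ (ν i : ℂ) := by exact_mod_cast (Finset.mem_erase.1 hk).1
    intro h
    apply hne
    linear_combination h
  · intro μ hμ hne
    obtain ⟨i, hi⟩ := Function.ne_iff.1 hne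
    refine Finset.prod_eq_zero (Finset.mem_univ i) ?_
    exact Finset.prod_eq_zero
      (Finset.mem_erase.2 ⟨hi, Finset.mem_image_of_mem (· i) hμ⟩) (sub_self _)

/-- A polynomial vanishing to second order at the squares of finitely many nonpositive integers
but not at the square of another given one. -/
lemma exists_polynomial_separating (N : Finset ℤ) {n : ℤ} (hn : n ≤ 0) :
    ∃ H : Polynomial ℂ, H.eval ((n : ℂ) ^ 2) ≠ 0 ∧
      ∀ m ∈ N, m ≤ 0 → m ≠ n → (Polynomial.X - Polynomial.C ((m : ℂ) ^ 2)) ^ 2 ∣ H := by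
  classical
  refine ⟨∏ m ∈ N.filter (fun m => m ≤ 0 ∧ m ≠ n),
    (Polynomial.X - Polynomial.C ((m : ℂ) ^ 2)) ^ 2, ?_, ?_⟩
  · rw [Polynomial.eval_prod]
    refine Finset.prod_ne_zero_iff.2 fun m hm => ?_
    obtain ⟨-, hm0, hmn⟩ := Finset.mem_filter.1 hm
    have hsq : n ^ 2 ≠ m ^ 2 := by
      intro h
      rcases sq_eq_sq_iff_eq_or_eq_neg.1 h with h | h <;> omega
    have hsq' : (n : ℂ) ^ 2 ≠ (m : ℂ) ^ 2 := by exact_mod_cast hsq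
    simpa [sub_eq_zero] using hsq'
  · intro m hm hm0 hmn
    exact Finset.dvd_prod_of_mem (fun m : ℤ => (Polynomial.X - Polynomial.C ((m : ℂ) ^ 2)) ^ 2)
      (Finset.mem_filter.2 ⟨hm, hm0, hmn⟩)

lemma eval_eq_zero_of_sq_dvd {G : Polynomial ℂ} {a : ℂ}
    (h : (Polynomial.X - Polynomial.C a) ^ 2 ∣ G) :
    G.eval a = 0 ∧ G.derivative.eval a = 0 := by
  obtain ⟨K, rfl⟩ := h
  simp [Polynomial.derivative_mul, Polynomial.derivative_pow]

/-- **Linear independence of the basis `ℬ_v` of local distributions.**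
If finitely supported coefficients `c` (supported on `{m ≤ 0}`) and `c′`
(supported on `{m < 0}`) satisfy
`Σ c_σ D¹_σ (F) + Σ c′_σ D²_σ (F) = 0` for every entire `τ`-invariant `F`,
then `c = 0` and `c′ = 0`. -/
theorem distributions_linear_independent (d : ℕ) (w₀ : Fin d → ℂ)
    (c c' : ℤ × (Fin d → ℤ) → ℂ)
    (hc : (Function.support c).Finite) (hc' : (Function.support c').Finite)
    (hcsupp : ∀ σ : ℤ × (Fin d → ℤ), c σ ≠ 0 → σ.1 ≤ 0)
    (hc'supp : ∀ σ : ℤ × (Fin d → ℤ), c' σ ≠ 0 → σ.1 < 0)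
    (hzero : ∀ F : ℂ × (Fin d → ℂ) → ℂ, AnalyticOnNhd ℂ F Set.univ →
      (∀ p, F (tauMap d p) = F p) →
      (∑ᶠ σ : ℤ × (Fin d → ℤ), c σ * D1 d w₀ σ F) +
        (∑ᶠ σ : ℤ × (Fin d → ℤ), c' σ * D2 d w₀ σ F) = 0) :
    c = 0 ∧ c' = 0 := by
  classical
  have hc'0 : c' = 0 := by
    funext σ₀
    by_contra hσ₀
    have hσ₀neg : σ₀.1 < 0 := hc'supp σ₀ hσ₀
    obtain ⟨R, hR, hR₀, hRz⟩ := exists_analytic_separating d w₀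
      ((hc.toFinset ∪ hc'.toFinset).image Prod.snd) σ₀.2
    obtain ⟨H, hH₀, hHz⟩ := exists_polynomial_separating
      ((hc.toFinset ∪ hc'.toFinset).image Prod.fst) hσ₀neg.le
    have key := hzero
      (evenProduct d (H * (Polynomial.X - Polynomial.C ((σ₀.1 : ℂ) ^ 2))) R)
      (analyticOnNhd_evenProduct d _ hR) (evenProduct_tauMap d _ R)
    simp only [D1_evenProduct, D2_evenProduct] at key
    have hdvd : ∀ σ : ℤ × (Fin d → ℤ), σ ∈ hc.toFinset ∪ hc'.toFinset → σ.1 ≤ 0 →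
        σ.1 ≠ σ₀.1 → (Polynomial.X - Polynomial.C ((σ.1 : ℂ) ^ 2)) ^ 2 ∣
          H * (Polynomial.X - Polynomial.C ((σ₀.1 : ℂ) ^ 2)) := fun σ hσ h0 hne =>
      (hHz σ.1 (Finset.mem_image_of_mem _ hσ) h0 hne).mul_right _
    rw [finsum_eq_zero_of_forall_eq_zero, finsum_eq_single _ σ₀] at key
    · have hm : (σ₀.1 : ℂ) ≠ 0 := by exact_mod_cast hσ₀neg.ne
      simp only [Polynomial.derivative_mul, Polynomial.derivative_sub, Polynomial.derivative_X,
        Polynomial.derivative_C, Polynomial.eval_add, Polynomial.eval_mul, Polynomial.eval_sub,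
        Polynomial.eval_X, Polynomial.eval_C, sub_self, mul_zero, sub_zero,
        mul_one, zero_add] at key
      exact mul_ne_zero hσ₀ (mul_ne_zero (mul_ne_zero hH₀
        (mul_ne_zero (neg_ne_zero.2 two_ne_zero) hm)) hR₀) key
    · intro σ hne
      by_cases hcσ : c' σ = 0
      · simp [hcσ]
      have hmem : σ ∈ hc.toFinset ∪ hc'.toFinset := by simp [hcσ]
      by_cases h1 : σ.1 = σ₀.1
      · have h2 : σ.2 ≠ σ₀.2 := fun h2 => hne (Prod.ext h1 h2)
        rw [hRz σ.2 (Finset.mem_image_of_mem _ hmem) h2, mul_zero, mul_zero]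
      · rw [(eval_eq_zero_of_sq_dvd (hdvd σ hmem (hc'supp σ hcσ).le h1)).2]
        ring
    · intro σ
      by_cases hcσ : c σ = 0
      · simp [hcσ]
      have hmem : σ ∈ hc.toFinset ∪ hc'.toFinset := by simp [hcσ]
      by_cases h1 : σ.1 = σ₀.1
      · simp [h1]
      · rw [(eval_eq_zero_of_sq_dvd (hdvd σ hmem (hcsupp σ hcσ) h1)).1]
        ring
  refine ⟨?_, hc'0⟩
  funext σ₀
  by_contra hσ₀
  obtain ⟨R, hR, hR₀, hRz⟩ := exists_analytic_separating d w₀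
    (hc.toFinset.image Prod.snd) σ₀.2
  obtain ⟨H, hH₀, hHz⟩ := exists_polynomial_separating
    (hc.toFinset.image Prod.fst) (hcsupp σ₀ hσ₀)
  have key := hzero (evenProduct d H R)
    (analyticOnNhd_evenProduct d _ hR) (evenProduct_tauMap d _ R)
  simp only [D1_evenProduct, hc'0, Pi.zero_apply, zero_mul, finsum_zero, add_zero] at key
  rw [finsum_eq_single _ σ₀] at key
  · exact mul_ne_zero hσ₀ (mul_ne_zero hH₀ hR₀) key
  · intro σ hne
    by_cases hcσ : c σ = 0
    · simp [hcσ]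
    have hmem : σ ∈ hc.toFinset := by simp [hcσ]
    by_cases h1 : σ.1 = σ₀.1
    · have h2 : σ.2 ≠ σ₀.2 := fun h2 => hne (Prod.ext h1 h2)
      rw [hRz σ.2 (Finset.mem_image_of_mem _ hmem) h2, mul_zero, mul_zero]
    · rw [(eval_eq_zero_of_sq_dvd
        (hHz σ.1 (Finset.mem_image_of_mem _ hmem) (hcsupp σ hcσ) h1)).1]
      ring

end
end

section
/- Let n ≥ 2 and 1 ≤ k ≤ n − 1. Consider points x assigning a complex number x_{r,s} to each pair 1 ≤ s ≤ r ≤ n. Fix i ≠ j in {1, …, k}, and let v be such a point with v_{k,i} = v_{k,j} and v_{k,s} ≠ v_{k,t} for every pair s ≠ t in {1, …, k} with {s, t} ≠ {i, j}. For s ∈ {1, …, k} define the rational functions f_s(x) = −(∏_{t=1}^{k+1} (x_{k,s} − x_{k+1,t})) / (∏_{t ∈ {1,…,k}, t ≠ s} (x_{k,s} − x_{k,t})) and g_s(x) = (∏_{t=1}^{k−1} (x_{k,s} − x_{k−1,t})) / (∏_{t ∈ {1,…,k}, t ≠ s} (x_{k,s} − x_{k,t})) (the empty product being 1 when k = 1).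 Then for every s ∈ {1, …, k}, each of the functions x ↦ (x_{k,i} − x_{k,j}) · f_s(x) and x ↦ (x_{k,i} − x_{k,j}) · g_s(x), defined on the set where the denominator ∏_{t ≠ s}(x_{k,s} − x_{k,t}) is nonzero, agrees there, in a neighborhood of v, with a function analytic at v. -/
open Topology Filter

noncomputable section

/-- The entry `x_{r,s}` (in `1`-based indexing, `1 ≤ s ≤ r ≤ n`) of a point
`x : Fin n → Fin n → ℂ`. -/
def ent (n : ℕ) (x : Fin n → Fin n → ℂ) (r s : ℕ) : ℂ :=
  if h : r - 1 < n ∧ s - 1 < n then x ⟨r - 1, h.1⟩ ⟨s - 1, h.2⟩ else 0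

/-- The Gelfand–Tsetlin coefficient
`f_s (x) = -(∏_{t=1}^{k+1} (x_{k,s} - x_{k+1,t})) / (∏_{t ≤ k, t ≠ s} (x_{k,s} - x_{k,t}))`
of the generator `E_{k,k+1}`. -/
def fcoef (n k s : ℕ) (x : Fin n → Fin n → ℂ) : ℂ :=
  -((∏ t ∈ Finset.Icc 1 (k + 1), (ent n x k s - ent n x (k + 1) t)) /
    (∏ t ∈ (Finset.Icc 1 k).erase s, (ent n x k s - ent n x k t)))

/-- The Gelfand–Tsetlin coefficient
`g_s (x) = (∏_{t=1}^{k-1} (x_{k,s} - x_{k-1,t})) / (∏_{t ≤ k, t ≠ s} (x_{k,s} - x_{k,t}))`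
of the generator `E_{k+1,k}` (the empty product being `1` when `k = 1`). -/
def gcoef (n k s : ℕ) (x : Fin n → Fin n → ℂ) : ℂ :=
  (∏ t ∈ Finset.Icc 1 (k - 1), (ent n x k s - ent n x (k - 1) t)) /
    (∏ t ∈ (Finset.Icc 1 k).erase s, (ent n x k s - ent n x k t))

theorem analyticAt_ent (n r s : ℕ) (v : Fin n → Fin n → ℂ) :
    AnalyticAt ℂ (fun x => ent n x r s) v := by
  unfold ent
  split_ifs with h
  · exact ((ContinuousLinearMap.proj (R := ℂ) (φ := fun _ : Fin n => ℂ) ⟨s - 1, h.2⟩).comp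
      (ContinuousLinearMap.proj (R := ℂ) (φ := fun _ : Fin n => Fin n → ℂ)
        ⟨r - 1, h.1⟩)).analyticAt v
  · exact analyticAt_const

theorem analyticAt_prod_ent_sub (n r r' s : ℕ) (T : Finset ℕ) (v : Fin n → Fin n → ℂ) :
    AnalyticAt ℂ (fun x => ∏ t ∈ T, (ent n x r s - ent n x r' t)) v :=
  Finset.analyticAt_fun_prod T fun t _ =>
    (analyticAt_ent n r s v).sub (analyticAt_ent n r' t v)

/-- If the entries with index in `S` differ from `v_{r,s}` except possibly the one at `t₀`, then
the reciprocal of the denominator has at most a simple pole along `x_{r,s} = x_{r,t₀}`. -/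
theorem exists_analyticAt_sub_mul_inv_prod (n r s t₀ : ℕ) (S : Finset ℕ) (ht₀ : t₀ ∈ S)
    (v : Fin n → Fin n → ℂ)
    (hv : ∀ t ∈ S.erase t₀, ent n v r s ≠ ent n v r t) :
    ∃ u : (Fin n → Fin n → ℂ) → ℂ, AnalyticAt ℂ u v ∧
      ∀ x, (∏ t ∈ S, (ent n x r s - ent n x r t)) ≠ 0 →
        (ent n x r s - ent n x r t₀) * (∏ t ∈ S, (ent n x r s - ent n x r t))⁻¹ = u x := by
  refine ⟨fun x => (∏ t ∈ S.erase t₀, (ent n x r s - ent n x r t))⁻¹,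
    (analyticAt_prod_ent_sub n r r s _ v).inv
      (Finset.prod_ne_zero_iff.2 fun t ht => sub_ne_zero.2 (hv t ht)), fun x hx => ?_⟩
  have h₀ := Finset.prod_ne_zero_iff.1 hx t₀ ht₀
  rw [← Finset.mul_prod_erase S _ ht₀, mul_inv, mul_inv_cancel_left₀ h₀]

/-- At a `1`-singular point the common denominator of the Gelfand–Tsetlin coefficients becomes
harmless after multiplication by `x_{k,i} - x_{k,j}`. -/
theorem exists_analyticAt_sub_mul_inv_denom (n k i j : ℕ)
    (hi : i ∈ Finset.Icc 1 k) (hj : j ∈ Finset.Icc 1 k) (hij : i ≠ j)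
    (v : Fin n → Fin n → ℂ)
    (hv : ∀ s ∈ Finset.Icc 1 k, ∀ t ∈ Finset.Icc 1 k, s ≠ t →
      ({s, t} : Finset ℕ) ≠ ({i, j} : Finset ℕ) → ent n v k s ≠ ent n v k t)
    (s : ℕ) (hs : s ∈ Finset.Icc 1 k) :
    ∃ u : (Fin n → Fin n → ℂ) → ℂ, AnalyticAt ℂ u v ∧
      ∀ x, (∏ t ∈ (Finset.Icc 1 k).erase s, (ent n x k s - ent n x k t)) ≠ 0 →
        (ent n x k i - ent n x k j) *
          (∏ t ∈ (Finset.Icc 1 k).erase s, (ent n x k s - ent n x k t))⁻¹ = u x := by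
  have key : ∀ t, s ≠ t → (s ≠ i ∨ t ≠ j) → (s ≠ j ∨ t ≠ i) →
      ({s, t} : Finset ℕ) ≠ ({i, j} : Finset ℕ) := by
    intro t hst h₁ h₂ h
    have h₃ : s ∈ ({i, j} : Finset ℕ) := h ▸ Finset.mem_insert_self s {t}
    have h₄ : t ∈ ({i, j} : Finset ℕ) := h ▸ by simp
    simp only [Finset.mem_insert, Finset.mem_singleton] at h₃ h₄
    omega
  by_cases hsi : s = i
  · subst hsi
    refine exists_analyticAt_sub_mul_inv_prod n k s j _
      (Finset.mem_erase.2 ⟨hij.symm, hj⟩) v fun t ht => ?_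
    simp only [Finset.mem_erase] at ht
    exact hv s hs t ht.2.2 (Ne.symm ht.2.1) (key t (Ne.symm ht.2.1) (.inr ht.1) (.inl hij))
  by_cases hsj : s = j
  · subst hsj
    obtain ⟨u, hu, hux⟩ := exists_analyticAt_sub_mul_inv_prod n k s i
      ((Finset.Icc 1 k).erase s) (Finset.mem_erase.2 ⟨hij, hi⟩) v fun t ht => by
        simp only [Finset.mem_erase] at ht
        exact hv s hs t ht.2.2 (Ne.symm ht.2.1) (key t (Ne.symm ht.2.1) (.inl hsi) (.inr ht.1))
    refine ⟨fun x => -u x, hu.neg, fun x hx => ?_⟩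
    simp only [← hux x hx]
    ring
  · refine ⟨_, ((analyticAt_ent n k i v).sub (analyticAt_ent n k j v)).mul
      ((analyticAt_prod_ent_sub n k k s ((Finset.Icc 1 k).erase s) v).inv
        (Finset.prod_ne_zero_iff.2 fun t ht => sub_ne_zero.2 ?_)), fun x _ => rfl⟩
    simp only [Finset.mem_erase] at ht
    exact hv s hs t ht.2 (Ne.symm ht.1) (key t (Ne.symm ht.1) (.inl hsi) (.inl hsj))

/-- **`Φ(X)` lies in the universal ring `𝒟_v` for each Gelfand–Tsetlin
generator `X`.**  At a `1`-singular point `v` (with the single coincidence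
`v_{k,i} = v_{k,j}` in row `k`), each coefficient of the classical
Gelfand–Tsetlin formulas, multiplied by `x_{k,i} - x_{k,j}`, agrees near `v`
(where its denominator is nonzero) with a function analytic at `v`. -/
theorem GT_coefficients_one_singular (n k : ℕ) (hn : 2 ≤ n)
    (hk1 : 1 ≤ k) (hkn : k ≤ n - 1)
    (i j : ℕ) (hi : i ∈ Finset.Icc 1 k) (hj : j ∈ Finset.Icc 1 k) (hij : i ≠ j)
    (v : Fin n → Fin n → ℂ)
    (hv1 : ent n v k i = ent n v k j)
    (hv2 : ∀ s ∈ Finset.Icc 1 k, ∀ t ∈ Finset.Icc 1 k, s ≠ t →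
      ({s, t} : Finset ℕ) ≠ ({i, j} : Finset ℕ) → ent n v k s ≠ ent n v k t) :
    ∀ s ∈ Finset.Icc 1 k,
      (∃ h : (Fin n → Fin n → ℂ) → ℂ, AnalyticAt ℂ h v ∧
        ∀ᶠ x in 𝓝 v,
          (∏ t ∈ (Finset.Icc 1 k).erase s, (ent n x k s - ent n x k t)) ≠ 0 →
          (ent n x k i - ent n x k j) * fcoef n k s x = h x) ∧
      (∃ h : (Fin n → Fin n → ℂ) → ℂ, AnalyticAt ℂ h v ∧
        ∀ᶠ x in 𝓝 v,
          (∏ t ∈ (Finset.Icc 1 k).erase s, (ent n x k s - ent n x k t)) ≠ 0 →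
          (ent n x k i - ent n x k j) * gcoef n k s x = h x) := by
  intro s hs
  obtain ⟨u, hu, hux⟩ := exists_analyticAt_sub_mul_inv_denom n k i j hi hj hij v hv2 s hs
  refine ⟨⟨_, (analyticAt_prod_ent_sub n k (k + 1) s (Finset.Icc 1 (k + 1)) v).neg.mul hu,
      .of_forall fun x hx => ?_⟩,
    ⟨_, (analyticAt_prod_ent_sub n k (k - 1) s (Finset.Icc 1 (k - 1)) v).mul hu,
      .of_forall fun x hx => ?_⟩⟩
  · simp only [fcoef, Pi.mul_apply, Pi.neg_apply, ← hux x hx]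
    ring
  · simp only [gcoef, Pi.mul_apply, ← hux x hx]
    ring

end
end
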